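/- arXiv:1211.2762 — 2 statements merged into one kernel-verified Lean document; each statement's English description precedes it below -/
import Mathlib

section
/- Let n ≥ 3 and p > 1, and assume ψ satisfies (H1)–(H3) and moreover that either limsup_{r→∞} ψ'(r)/ψ(r) < +∞, or lim_{r→∞} ψ'(r)/ψ(r) = +∞ with [log(ψ'(r)/ψ(r))]' bounded as r → ∞ and ∫₀^∞ ψ(s)/ψ'(s) ds = ∞. Then every radial solution of the Lane–Emden–Fowler equation is stable outside a compact set: there exists R > 0 such that ∫₀^∞ χ'(r)² ψ(r)^{n−1} dr ≥ p ∫₀^∞ |u(r)|^{p−1} χ(r)² ψ(r)^{n−1} dr for every C¹ function χ : [0, ∞) → ℝ with compact support contained in (R, ∞). -/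
open Real MeasureTheory Filter Set Asymptotics

noncomputable section

/-- (H1): ψ is C² on [0,∞), ψ(0) = ψ''(0) = 0, ψ'(0) = 1, ψ > 0 on (0,∞). -/
def H1 (ψ : ℝ → ℝ) : Prop :=
  ContDiffOn ℝ 2 ψ (Ici 0) ∧ ψ 0 = 0 ∧ deriv ψ 0 = 1 ∧
    deriv (deriv ψ) 0 = 0 ∧ ∀ r > (0 : ℝ), 0 < ψ r

/-- (H2): ψ' ≥ 0 on (0,∞). -/
def H2 (ψ : ℝ → ℝ) : Prop := ∀ r > (0 : ℝ), 0 ≤ deriv ψ r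

/-- (H3): liminf_{r→∞} ψ'(r)/ψ(r) > 0, i.e. ψ'/ψ is eventually bounded below
by a positive constant. -/
def H3 (ψ : ℝ → ℝ) : Prop := ∃ c > (0 : ℝ), ∀ᶠ r in atTop, c ≤ deriv ψ r / ψ r

/-- A radial solution of the Lane–Emden–Fowler equation with initial value α. -/
def IsRadialSolution (n : ℕ) (p : ℝ) (ψ u : ℝ → ℝ) (α : ℝ) : Prop :=
  ContDiffOn ℝ 2 u (Ici 0) ∧ u 0 = α ∧ deriv u 0 = 0 ∧
    ∀ r > (0 : ℝ), deriv (deriv u) r + ((n : ℝ) - 1) * (deriv ψ r / ψ r) * deriv u r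
      + |u r| ^ (p - 1) * u r = 0

/-- [log(ψ'/ψ)]' is bounded as r → ∞. -/
def LogDerivBounded (ψ : ℝ → ℝ) : Prop :=
  ∃ C : ℝ, ∀ᶠ r in atTop, |deriv (fun s => Real.log (deriv ψ s / ψ s)) r| ≤ C

theorem integral_mul_sq_le_integral_deriv_sq {w w' V χ : ℝ → ℝ} {R a : ℝ} (hR : 0 ≤ R)
    (ha : 0 ≤ a) (hw : ∀ r ≥ R, HasDerivAt w (w' r) r) (hw' : ContinuousOn w' (Ici R))
    (hw0 : ∀ r ≥ R, 0 ≤ w r) (hww : ∀ r ≥ R, 2 * a * w r ≤ w' r)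
    (hV : ContinuousOn V (Ici R)) (hVa : ∀ r ≥ R, V r ≤ a ^ 2)
    (hχ : ContDiff ℝ 1 χ) (hc : HasCompactSupport χ) (hs : tsupport χ ⊆ Ioi R) :
    ∫ r in Ioi (0 : ℝ), V r * χ r ^ 2 * w r ≤ ∫ r in Ioi (0 : ℝ), deriv χ r ^ 2 * w r := by
  obtain ⟨b₀, hb₀⟩ := hc.isCompact.bddAbove
  obtain ⟨b, hRb, hb⟩ : ∃ b, R ≤ b ∧ b₀ < b :=
    ⟨max R (b₀ + 1), le_max_left _ _, lt_of_lt_of_le (by linarith) (le_max_right _ _)⟩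
  have hout : ∀ r, r ∉ Ioo R b → r ∉ tsupport χ := fun r hr hmem =>
    hr ⟨hs hmem, (hb₀ hmem).trans_lt hb⟩
  have hχ0 : ∀ r, r ∉ Ioo R b → χ r = 0 := fun r hr => image_eq_zero_of_notMem_tsupport (hout r hr)
  have hχ'0 : ∀ r, r ∉ Ioo R b → deriv χ r = 0 := fun r hr =>
    image_eq_zero_of_notMem_tsupport fun hmem => hout r hr (tsupport_deriv_subset hmem)
  have hsub : Ioc R b ⊆ Ioi 0 := fun r hr => hR.trans_lt hr.1
  have restrict : ∀ f : ℝ → ℝ, (∀ r, r ∉ Ioo R b → f r = 0) →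
      ∫ r in Ioi (0 : ℝ), f r = ∫ r in R..b, f r := fun f hf => by
    rw [intervalIntegral.integral_of_le hRb]
    refine setIntegral_eq_of_subset_of_forall_sdiff_eq_zero measurableSet_Ioi hsub fun r hr => ?_
    exact hf r fun h => hr.2 ⟨h.1, h.2.le⟩
  rw [restrict _ fun r hr => by simp [hχ0 r hr], restrict _ fun r hr => by simp [hχ'0 r hr]]
  have hIcc : uIcc R b ⊆ Ici R := by
    rw [uIcc_of_le hRb]; exact Icc_subset_Ici_self
  have hχc : Continuous χ := hχ.continuous
  have hχ'c : Continuous (deriv χ) := hχ.continuous_deriv le_rfl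
  have hwc : ContinuousOn w (uIcc R b) := fun r hr =>
    (hw r (hIcc hr)).continuousAt.continuousWithinAt
  have hw'c : ContinuousOn w' (uIcc R b) := hw'.mono hIcc
  have hVc : ContinuousOn V (uIcc R b) := hV.mono hIcc
  have hdc : ContinuousOn (fun r => 2 * χ r * deriv χ r * w r + χ r ^ 2 * w' r) (uIcc R b) := by
    fun_prop
  have hFTC : ∫ r in R..b, (2 * χ r * deriv χ r * w r + χ r ^ 2 * w' r) = 0 := by
    rw [intervalIntegral.integral_eq_sub_of_hasDerivAt (f := fun r => χ r ^ 2 * w r) _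
      hdc.intervalIntegrable]
    · simp [hχ0 R (by simp), hχ0 b (by simp)]
    · intro r hr
      have h := (hχ.differentiable one_ne_zero r).hasDerivAt
      refine ((h.pow 2).mul (hw r (hIcc hr))).congr_deriv ?_
      simp
  have hi : IntervalIntegrable (fun r => deriv χ r ^ 2 * w r) volume R b :=
    ContinuousOn.intervalIntegrable (by fun_prop)
  have hmono : ∫ r in R..b, V r * χ r ^ 2 * w r ≤ ∫ r in R..b, (deriv χ r ^ 2 * w r +
      a * (2 * χ r * deriv χ r * w r + χ r ^ 2 * w' r)) := by
    refine intervalIntegral.integral_mono_on hRb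
      (ContinuousOn.intervalIntegrable (by fun_prop))
      (hi.add (hdc.intervalIntegrable.const_mul a)) fun r hr => ?_
    have h1 := mul_nonneg (sq_nonneg (deriv χ r + a * χ r)) (hw0 r hr.1)
    have h2 := mul_le_mul_of_nonneg_left (hww r hr.1) (mul_nonneg ha (sq_nonneg (χ r)))
    have h3 := mul_le_mul_of_nonneg_right (hVa r hr.1)
      (mul_nonneg (sq_nonneg (χ r)) (hw0 r hr.1))
    linarith
  rwa [intervalIntegral.integral_add hi (hdc.intervalIntegrable.const_mul a),
    intervalIntegral.integral_const_mul, hFTC, mul_zero, add_zero] at hmono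

theorem hasDerivAt_abs_rpow_mul_self {p : ℝ} (hp : 1 < p) (x : ℝ) :
    HasDerivAt (fun y : ℝ => |y| ^ (p - 1) * y) (p * |x| ^ (p - 1)) x := by
  rcases eq_or_ne x 0 with rfl | hx
  · rw [hasDerivAt_iff_tendsto_slope]
    have hcont : Tendsto (fun y : ℝ => |y| ^ (p - 1)) (nhdsWithin 0 {0}ᶜ)
        (nhds (p * |(0 : ℝ)| ^ (p - 1))) := by
      have h : ContinuousAt (fun y : ℝ => |y| ^ (p - 1)) 0 :=
        continuous_abs.continuousAt.rpow_const (Or.inr (by linarith))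
      have h0 : (0 : ℝ) ^ (p - 1) = 0 := Real.zero_rpow (by linarith)
      simpa [ContinuousAt, h0] using h.tendsto.mono_left nhdsWithin_le_nhds
    refine hcont.congr' ?_
    filter_upwards [self_mem_nhdsWithin] with y hy
    have hy : y ≠ 0 := hy
    simp [slope_def_field, hy]
  · have h := ((hasDerivAt_abs hx).rpow_const (p := p - 1) (Or.inl (abs_ne_zero.2 hx))).mul
      (hasDerivAt_id x)
    refine h.congr_deriv ?_
    have hsx : (SignType.sign x : ℝ) * x = |x| := by rw [mul_comm, self_mul_sign]
    have hpow : |x| ^ (p - 1) = |x| ^ (p - 1 - 1) * |x| := by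
      rw [← Real.rpow_add_one (abs_ne_zero.2 hx)]; congr 1; ring
    simp only [id]
    rw [hpow]
    linear_combination (p - 1) * |x| ^ (p - 1 - 1) * hsx

/-- The energy of a state `(u, v)` of the Lane–Emden–Fowler equation. -/
def energy (p u v : ℝ) : ℝ := v ^ 2 / 2 + |u| ^ (p + 1) / (p + 1)

section Damped

variable {p R : ℝ} {u v q : ℝ → ℝ}

theorem energy_antitoneOn (hp : 1 < p) (hu : ∀ r ≥ R, HasDerivAt u (v r) r)
    (hv : ∀ r ≥ R, HasDerivAt v (-(q r * v r) - |u r| ^ (p - 1) * u r) r)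
    (hq : ∀ r ≥ R, 0 ≤ q r) : AntitoneOn (fun r => energy p (u r) (v r)) (Ici R) := by
  have hd : ∀ r ≥ R, HasDerivAt (fun r => energy p (u r) (v r)) (-(q r * v r ^ 2)) r := by
    intro r hr
    have h1 := ((hv r hr).pow 2).div_const 2
    have h2 := ((hasDerivAt_abs_rpow (u r) (p := p + 1) (by linarith)).comp r
      (hu r hr)).div_const (p + 1)
    refine (h1.add h2).congr_deriv ?_
    have : p + 1 ≠ 0 := by linarith
    have he : p + 1 - 2 = p - 1 := by ring
    rw [he]
    field_simp
    push_cast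
    ring
  refine antitoneOn_of_deriv_nonpos (convex_Ici R)
    (fun r hr => (hd r hr).continuousAt.continuousWithinAt)
    (fun r hr => (hd r (interior_subset hr)).differentiableAt.differentiableWithinAt)
    fun r hr => ?_
  have hr := interior_subset hr
  rw [(hd r hr).deriv]
  exact neg_nonpos.2 (mul_nonneg (hq r hr) (sq_nonneg _))

theorem abs_lt_of_energy_lt (hp : 1 < p) {x y s : ℝ} (hs : 0 ≤ s)
    (h : energy p x y < s ^ (p + 1) / (p + 1)) : |x| < s := by
  have h1 : |x| ^ (p + 1) / (p + 1) < s ^ (p + 1) / (p + 1) := by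
    unfold energy at h; linarith [sq_nonneg y]
  rw [div_lt_div_iff_of_pos_right (by linarith)] at h1
  exact (Real.rpow_lt_rpow_iff (abs_nonneg x) hs (by linarith)).1 h1

theorem exists_bound (hp : 1 < p) (hu : ∀ r ≥ R, HasDerivAt u (v r) r)
    (hv : ∀ r ≥ R, HasDerivAt v (-(q r * v r) - |u r| ^ (p - 1) * u r) r)
    (hq : ∀ r ≥ R, 0 ≤ q r) : ∃ M > 0, ∀ r ≥ R, |u r| ≤ M ∧ |v r| ≤ M := by
  set e := energy p (u R) (v R) with he
  have hp1 : 0 < p + 1 := by linarith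
  have he0 : 0 ≤ e := by rw [he, energy]; positivity
  have hs : (((p + 1) * (e + 1)) ^ (p + 1)⁻¹) ^ (p + 1) = (p + 1) * (e + 1) :=
    Real.rpow_inv_rpow (by positivity) hp1.ne'
  refine ⟨max (((p + 1) * (e + 1)) ^ (p + 1)⁻¹) (2 * e + 1), lt_max_of_lt_right (by linarith),
    fun r hr => ?_⟩
  have hle : energy p (u r) (v r) ≤ e :=
    energy_antitoneOn hp hu hv hq (mem_Ici.2 le_rfl) (mem_Ici.2 hr) hr
  constructor
  · refine le_max_of_le_left (abs_lt_of_energy_lt (y := v r) hp (by positivity) ?_).le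
    rw [hs, mul_div_cancel_left₀ _ hp1.ne']
    linarith
  · refine le_max_of_le_right (abs_le_of_sq_le_sq (b := 2 * e + 1) ?_ (by linarith))
    have : 0 ≤ |u r| ^ (p + 1) / (p + 1) := by positivity
    unfold energy at hle
    nlinarith

/-- With damping bounded above and away from zero, the energy falls below every positive level. -/
theorem exists_energy_lt (hp : 1 < p) (hu : ∀ r ≥ R, HasDerivAt u (v r) r)
    (hv : ∀ r ≥ R, HasDerivAt v (-(q r * v r) - |u r| ^ (p - 1) * u r) r)
    {c A δ : ℝ} (hc : 0 < c) (hq : ∀ r ≥ R, c ≤ q r) (hqA : ∀ r ≥ R, q r ≤ A) (hδ : 0 < δ) :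
    ∃ r ≥ R, energy p (u r) (v r) < δ := by
  by_contra! hE
  obtain ⟨M, hM, hb⟩ := exists_bound hp hu hv fun r hr => hc.le.trans (hq r hr)
  set B := M ^ (p - 1) with hB
  have hB0 : 0 < B := by positivity
  set g : ℝ → ℝ := fun r => |u r| ^ (p - 1) * u r with hg
  have hBu : ∀ r ≥ R, |u r| ^ (p - 1) ≤ B := fun r hr =>
    Real.rpow_le_rpow (abs_nonneg _) (hb r hr).1 (by linarith)
  have hgabs : ∀ r, |g r| = |u r| ^ (p - 1) * |u r| := fun r => by
    rw [hg, abs_mul, abs_of_nonneg (by positivity)]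
  have hgB : ∀ r ≥ R, |g r| ≤ B * M := fun r hr => by
    rw [hgabs]
    exact mul_le_mul (hBu r hr) (hb r hr).1 (abs_nonneg _) hB0.le
  obtain ⟨ε, hε, hεc⟩ : ∃ ε > 0, ε * (p * B + A ^ 2 / 2) ≤ c / 2 := by
    have hD : 0 < p * B + A ^ 2 / 2 := by positivity
    exact ⟨c / 2 / (p * B + A ^ 2 / 2), by positivity, (div_mul_cancel₀ _ hD.ne').le⟩
  set F : ℝ → ℝ := fun r => v r ^ 2 / 2 + |u r| ^ (p + 1) / (p + 1) + ε * (g r * v r) with hF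
  have hFd : ∀ r ≥ R, HasDerivAt F (-(q r * v r ^ 2) + ε * (p * |u r| ^ (p - 1) * v r * v r
      + g r * (-(q r * v r) - g r))) r := by
    intro r hr
    have h1 := ((hv r hr).pow 2).div_const 2
    have h2 := ((hasDerivAt_abs_rpow (u r) (p := p + 1) (by linarith)).comp r
      (hu r hr)).div_const (p + 1)
    have h3 := (((hasDerivAt_abs_rpow_mul_self hp (u r)).comp r (hu r hr)).mul
      (hv r hr)).const_mul ε
    refine ((h1.add h2).add h3).congr_deriv ?_
    have : p + 1 ≠ 0 := by linarith
    have he : p + 1 - 2 = p - 1 := by ring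
    simp only [he, hg, Function.comp]
    field_simp
    push_cast
    ring
  obtain ⟨η, hη, hdη⟩ : ∃ η > 0, ∀ r ≥ R, deriv F r ≤ -η := by
    have hlow : ∀ r ≥ R, min δ ((δ / (2 * M)) ^ 2) ≤ v r ^ 2 + g r ^ 2 := by
      intro r hr
      have h1 := hE r hr
      unfold energy at h1
      have hpow : |u r| ^ (p + 1) / (p + 1) ≤ |g r| * M := by
        have h2 : |u r| ^ (p + 1) = |g r| * |u r| := by
          rw [hgabs]
          rcases eq_or_ne (u r) 0 with h0 | h0
          · simp [h0, Real.zero_rpow (by linarith : p + 1 ≠ 0)]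
          · rw [← Real.rpow_add_one (abs_ne_zero.2 h0), ← Real.rpow_add_one (abs_ne_zero.2 h0)]
            congr 1; ring
        have h3 : |g r| * |u r| ≤ |g r| * M :=
          mul_le_mul_of_nonneg_left (hb r hr).1 (abs_nonneg _)
        rw [h2]
        exact (div_le_self (by positivity) (by linarith)).trans h3
      rcases le_total δ (v r ^ 2) with h | h
      · exact (min_le_left _ _).trans (by linarith [sq_nonneg (g r)])
      · refine (min_le_right _ _).trans ?_
        have h4 : δ / (2 * M) ≤ |g r| := by
          rw [div_le_iff₀ (by positivity)]; linarith
        have h5 := pow_le_pow_left₀ (by positivity) h4 2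
        rw [sq_abs] at h5
        linarith [sq_nonneg (v r)]
    refine ⟨min (c / 2) (ε / 2) * min δ ((δ / (2 * M)) ^ 2), by positivity, fun r hr => ?_⟩
    rw [(hFd r hr).deriv]
    have h1 : c * v r ^ 2 ≤ q r * v r ^ 2 := mul_le_mul_of_nonneg_right (hq r hr) (sq_nonneg _)
    have h2 : ε * (p * |u r| ^ (p - 1) * v r * v r) ≤ ε * (p * B * v r ^ 2) := by
      have := mul_le_mul_of_nonneg_left (hBu r hr)
        (by positivity : 0 ≤ ε * (p * v r ^ 2))
      linarith
    have hq0 : 0 ≤ q r := hc.le.trans (hq r hr)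
    have h3 : ε * (-(q r * v r * g r)) ≤ ε * (g r ^ 2 / 2 + A ^ 2 * v r ^ 2 / 2) := by
      have h4 : q r ^ 2 * v r ^ 2 ≤ A ^ 2 * v r ^ 2 :=
        mul_le_mul_of_nonneg_right (pow_le_pow_left₀ hq0 (hqA r hr) 2) (sq_nonneg _)
      refine mul_le_mul_of_nonneg_left ?_ hε.le
      nlinarith [sq_nonneg (q r * v r + g r)]
    have h5 := mul_le_mul_of_nonneg_right hεc (sq_nonneg (v r))
    have h6 : min (c / 2) (ε / 2) * min δ ((δ / (2 * M)) ^ 2) ≤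
        min (c / 2) (ε / 2) * (v r ^ 2 + g r ^ 2) :=
      mul_le_mul_of_nonneg_left (hlow r hr) (by positivity)
    have h7 := mul_le_mul_of_nonneg_right (min_le_left (c / 2) (ε / 2)) (sq_nonneg (v r))
    have h8 := mul_le_mul_of_nonneg_right (min_le_right (c / 2) (ε / 2)) (sq_nonneg (g r))
    linarith
  have hFlow : ∀ r ≥ R, -(ε * (B * M * M)) ≤ F r := by
    intro r hr
    have h1 : |g r * v r| ≤ B * M * M := by
      rw [abs_mul]
      exact mul_le_mul (hgB r hr) (hb r hr).2 (abs_nonneg _) (by positivity)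
    have h2 := mul_le_mul_of_nonneg_left (neg_le_of_abs_le h1) hε.le
    have h3 : 0 ≤ v r ^ 2 / 2 + |u r| ^ (p + 1) / (p + 1) := by
      have : 0 < p + 1 := by linarith
      positivity
    simp only [hF]
    linarith
  have hF0 := hFlow R le_rfl
  set T := R + (F R + ε * (B * M * M) + 1) / η with hT
  have hRT : R ≤ T := by
    have : 0 ≤ (F R + ε * (B * M * M) + 1) / η := div_nonneg (by linarith) hη.le
    linarith
  have hdec := Convex.image_sub_le_mul_sub_of_deriv_le (convex_Ici R)
    (fun r hr => (hFd r hr).continuousAt.continuousWithinAt)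
    (fun r hr => (hFd r (interior_subset hr)).differentiableAt.differentiableWithinAt)
    (fun r hr => hdη r (interior_subset hr)) R (mem_Ici.2 le_rfl) T hRT hRT
  have hTη : η * (T - R) = F R + ε * (B * M * M) + 1 := by
    rw [hT]; field_simp; ring
  linarith [hFlow T hRT]

end Damped

theorem ContDiffOn.hasDerivAt_deriv_of_Ici {f : ℝ → ℝ} (hf : ContDiffOn ℝ 2 f (Ici 0)) {r : ℝ}
    (hr : 0 < r) : HasDerivAt f (deriv f r) r ∧ HasDerivAt (deriv f) (deriv (deriv f) r) r := by
  have h2 : ContDiffOn ℝ (1 + 1) f (Ioi 0) := by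
    norm_num; exact hf.mono Ioi_subset_Ici_self
  obtain ⟨hd, -, hd'⟩ := (contDiffOn_succ_iff_deriv_of_isOpen isOpen_Ioi).1 h2
  exact ⟨(hd.differentiableAt (Ioi_mem_nhds hr)).hasDerivAt,
    ((hd'.differentiableOn one_ne_zero).differentiableAt (Ioi_mem_nhds hr)).hasDerivAt⟩

/-- Stability outside a compact set: under the stated alternatives on ψ, every
radial solution is stable outside a compact set, i.e. the stability inequality
holds for all test functions supported in (R,∞) for some R > 0. -/
theorem statement17 (n : ℕ) (hn : 3 ≤ n) (p : ℝ) (hp : 1 < p) (ψ : ℝ → ℝ)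
    (h1 : H1 ψ) (h2 : H2 ψ) (h3 : H3 ψ)
    (halt : (∃ C : ℝ, ∀ᶠ r in atTop, deriv ψ r / ψ r ≤ C) ∨
      (Tendsto (fun r => deriv ψ r / ψ r) atTop atTop ∧ LogDerivBounded ψ ∧
        ¬ IntegrableOn (fun s => ψ s / deriv ψ s) (Ioi 0)))
    (u : ℝ → ℝ) (α : ℝ) (hu : IsRadialSolution n p ψ u α) :
    ∃ R : ℝ, 0 < R ∧ ∀ χ : ℝ → ℝ, ContDiff ℝ 1 χ → HasCompactSupport χ →
      tsupport χ ⊆ Ioi R →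
      p * ∫ r in Ioi (0:ℝ), |u r| ^ (p - 1) * (χ r) ^ 2 * ψ r ^ (n - 1) ≤
        ∫ r in Ioi (0:ℝ), (deriv χ r) ^ 2 * ψ r ^ (n - 1) := by
  obtain ⟨hψ, -, -, -, hψ0⟩ := h1
  obtain ⟨hu2, -, -, hode⟩ := hu
  obtain ⟨c, hc, hc'⟩ := h3
  have hk : (0 : ℝ) < (n : ℝ) - 1 := by
    have : (3 : ℝ) ≤ n := by exact_mod_cast hn
    linarith
  have hud : ∀ r > (0 : ℝ), HasDerivAt u (deriv u r) r := fun r hr =>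
    (hu2.hasDerivAt_deriv_of_Ici hr).1
  have hvd : ∀ r > (0 : ℝ), HasDerivAt (deriv u)
      (-(((n : ℝ) - 1) * (deriv ψ r / ψ r) * deriv u r) - |u r| ^ (p - 1) * u r) r := fun r hr =>
    (hu2.hasDerivAt_deriv_of_Ici hr).2.congr_deriv (by linarith [hode r hr])
  obtain ⟨R, a, hR, ha, hRa, hRu⟩ : ∃ R a : ℝ, 0 < R ∧ 0 ≤ a ∧
      (∀ r ≥ R, 2 * a ≤ ((n : ℝ) - 1) * (deriv ψ r / ψ r)) ∧
      ∀ r ≥ R, p * |u r| ^ (p - 1) ≤ a ^ 2 := by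
    rcases halt with ⟨C, hC⟩ | ⟨htend, -⟩
    · obtain ⟨R, hR⟩ := eventually_atTop.1 ((hc'.and hC).and (eventually_gt_atTop 0))
      have hR0 : 0 < R := (hR R le_rfl).2
      have hq : ∀ r ≥ R, ((n : ℝ) - 1) * c ≤ ((n : ℝ) - 1) * (deriv ψ r / ψ r) := fun r hr =>
        mul_le_mul_of_nonneg_left (hR r hr).1.1 hk.le
      have hqC : ∀ r ≥ R, ((n : ℝ) - 1) * (deriv ψ r / ψ r) ≤ ((n : ℝ) - 1) * C := fun r hr =>
        mul_le_mul_of_nonneg_left (hR r hr).1.2 hk.le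
      set a := ((n : ℝ) - 1) * c / 2 with ha
      have ha0 : 0 < a := by positivity
      set s := (a ^ 2 / p) ^ (p - 1)⁻¹ with hs
      have hs0 : 0 < s := by positivity
      have hsp : s ^ (p - 1) = a ^ 2 / p := Real.rpow_inv_rpow (by positivity) (by linarith)
      have hud' : ∀ r ≥ R, HasDerivAt u (deriv u r) r := fun r hr => hud r (hR r hr).2
      have hvd' := fun r (hr : r ≥ R) => hvd r (hR r hr).2
      obtain ⟨T, hT, hET⟩ := exists_energy_lt hp hud' hvd' (by positivity) hq hqC
        (by positivity : 0 < s ^ (p + 1) / (p + 1))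
      refine ⟨T, a, hR0.trans_le hT, ha0.le, fun r hr => ?_, fun r hr => ?_⟩
      · linarith [hq r (hT.trans hr)]
      · have hmono := energy_antitoneOn hp hud' hvd'
          (fun r hr => (mul_pos hk hc).le.trans (hq r hr)) (mem_Ici.2 hT)
          (mem_Ici.2 (hT.trans hr)) hr
        have hlt := abs_lt_of_energy_lt hp hs0.le (hmono.trans_lt hET)
        have h := Real.rpow_le_rpow (abs_nonneg _) hlt.le (by linarith : 0 ≤ p - 1)
        rwa [hsp, le_div_iff₀ (by linarith), mul_comm] at h
    · have hq : ∀ r ≥ (1 : ℝ), 0 ≤ ((n : ℝ) - 1) * (deriv ψ r / ψ r) := fun r hr =>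
        mul_nonneg hk.le (div_nonneg (h2 r (by linarith)) (hψ0 r (by linarith)).le)
      obtain ⟨M, hM, hb⟩ := exists_bound hp (fun r (hr : r ≥ 1) => hud r (by linarith))
        (fun r hr => hvd r (by linarith)) hq
      set a := √(p * M ^ (p - 1)) with ha
      obtain ⟨R, hR⟩ := eventually_atTop.1
        ((htend.eventually_ge_atTop (2 * a / ((n : ℝ) - 1))).and (eventually_ge_atTop 1))
      refine ⟨R, a, by linarith [(hR R le_rfl).2], Real.sqrt_nonneg _, fun r hr => ?_,
        fun r hr => ?_⟩
      · have h := (hR r hr).1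
        rw [div_le_iff₀ hk] at h
        linarith
      · rw [ha, Real.sq_sqrt (by positivity)]
        exact mul_le_mul_of_nonneg_left (Real.rpow_le_rpow (abs_nonneg _)
          (hb r (hR r hr).2).1 (by linarith)) (by linarith)
  refine ⟨R, hR, fun χ hχ hcs hsupp => ?_⟩
  have hψd : ∀ r ≥ R, HasDerivAt ψ (deriv ψ r) r := fun r hr =>
    (hψ.hasDerivAt_deriv_of_Ici (hR.trans_le hr)).1
  have hψc : ContinuousOn ψ (Ici R) := fun r hr => (hψd r hr).continuousAt.continuousWithinAt
  have hψ'c : ContinuousOn (deriv ψ) (Ici R) := fun r hr =>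
    (hψ.hasDerivAt_deriv_of_Ici (hR.trans_le hr)).2.continuousAt.continuousWithinAt
  have huc : ContinuousOn u (Ici R) := fun r hr =>
    (hud r (hR.trans_le hr)).continuousAt.continuousWithinAt
  have key := integral_mul_sq_le_integral_deriv_sq (w := fun r => ψ r ^ (n - 1))
    (w' := fun r => ((n - 1 : ℕ) : ℝ) * ψ r ^ (n - 1 - 1) * deriv ψ r)
    (V := fun r => p * |u r| ^ (p - 1)) hR.le ha (fun r hr => (hψd r hr).pow (n - 1))
    (by fun_prop) (fun r hr => pow_nonneg (hψ0 r (hR.trans_le hr)).le _)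
    (fun r hr => by
      have hpos := hψ0 r (hR.trans_le hr)
      have hpow : ψ r ^ (n - 1) = ψ r ^ (n - 1 - 1) * ψ r := by
        rw [← pow_succ]; congr 1; omega
      have h := mul_le_mul_of_nonneg_right (hRa r hr) (pow_nonneg hpos.le (n - 1))
      refine h.trans_eq ?_
      rw [hpow, Nat.cast_sub (by omega)]
      push_cast
      field_simp)
    (continuousOn_const.mul (huc.abs.rpow_const fun r _ => Or.inr (by linarith)))
    hRu hχ hcs hsupp
  rw [← integral_const_mul]
  simpa only [mul_assoc] using key
end
end

section
/- Let n ≥ 3 and p > 1, and assume ψ satisfies (H1)–(H3). Let λ₁ > 0 be the radial Poincaré constant. If α is a real number with 0 < |α| ≤ (λ₁/p)^{1/(p−1)}, then the radial solution u_α with initial value α is stable. -/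
open Real MeasureTheory Filter Set Asymptotics

noncomputable section

/-- Linearized stability of a radial solution. -/
def Stable (n : ℕ) (p : ℝ) (ψ u : ℝ → ℝ) : Prop :=
  ∀ χ : ℝ → ℝ, ContDiff ℝ 1 χ → HasCompactSupport χ →
    p * ∫ r in Ioi (0:ℝ), |u r| ^ (p - 1) * (χ r) ^ 2 * ψ r ^ (n - 1) ≤
      ∫ r in Ioi (0:ℝ), (deriv χ r) ^ 2 * ψ r ^ (n - 1)

/-- The radial Poincaré constant λ₁: the infimum of the Rayleigh quotients of
nonzero compactly supported C¹ functions. -/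
def lam1 (n : ℕ) (ψ : ℝ → ℝ) : ℝ :=
  sInf { q : ℝ | ∃ φ : ℝ → ℝ, ContDiff ℝ 1 φ ∧ HasCompactSupport φ ∧
    (∫ r in Ioi (0:ℝ), (φ r) ^ 2 * ψ r ^ (n - 1)) ≠ 0 ∧
    q = (∫ r in Ioi (0:ℝ), (deriv φ r) ^ 2 * ψ r ^ (n - 1)) /
        (∫ r in Ioi (0:ℝ), (φ r) ^ 2 * ψ r ^ (n - 1)) }

theorem ContDiffOn.contDiffAt_of_pos {f : ℝ → ℝ} (hf : ContDiffOn ℝ 2 f (Ici 0)) {r : ℝ}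
    (hr : 0 < r) : ContDiffAt ℝ 2 f r :=
  hf.contDiffAt (Ici_mem_nhds hr)

theorem ContDiffOn.hasDerivAt_of_pos {f : ℝ → ℝ} (hf : ContDiffOn ℝ 2 f (Ici 0)) {r : ℝ}
    (hr : 0 < r) : HasDerivAt f (deriv f r) r :=
  ((hf.contDiffAt_of_pos hr).differentiableAt (by norm_num)).hasDerivAt

theorem derivWithin_Ici_zero_of_pos {f : ℝ → ℝ} {r : ℝ} (hr : 0 < r) :
    derivWithin f (Ici 0) r = deriv f r :=
  derivWithin_of_mem_nhds (Ici_mem_nhds hr)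

theorem ContDiffOn.contDiffOn_derivWithin_Ici {f : ℝ → ℝ} (hf : ContDiffOn ℝ 2 f (Ici 0)) :
    ContDiffOn ℝ 1 (derivWithin f (Ici 0)) (Ici 0) :=
  hf.derivWithin (uniqueDiffOn_Ici 0) (by norm_num)

theorem ContDiffOn.hasDerivAt_derivWithin_of_pos {f : ℝ → ℝ} (hf : ContDiffOn ℝ 2 f (Ici 0))
    {r : ℝ} (hr : 0 < r) : HasDerivAt (derivWithin f (Ici 0)) (deriv (deriv f) r) r := by
  have h : HasDerivAt (derivWithin f (Ici 0)) (deriv (derivWithin f (Ici 0)) r) r :=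
    ((hf.contDiffOn_derivWithin_Ici.contDiffAt (Ici_mem_nhds hr)).differentiableAt
      (by norm_num)).hasDerivAt
  have he : derivWithin f (Ici 0) =ᶠ[nhds r] deriv f := by
    filter_upwards [Ioi_mem_nhds hr] with x hx using derivWithin_Ici_zero_of_pos hx
  rwa [he.deriv_eq] at h

/-- The one-sided derivative of a radial solution at the origin vanishes: a nonzero value would make
`u''` unbounded near the origin. -/
theorem IsRadialSolution.derivWithin_zero {n : ℕ} {p : ℝ} {ψ u : ℝ → ℝ} {α : ℝ} (hn : 3 ≤ n)
    (hp : 1 < p) (h1 : H1 ψ) (hu : IsRadialSolution n p ψ u α) :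
    derivWithin u (Ici 0) 0 = 0 := by
  obtain ⟨hψ, hψ0, hψ1, -, hψpos⟩ := h1
  obtain ⟨hu2, -, -, hode⟩ := hu
  have hψd : derivWithin ψ (Ici 0) 0 = 1 := by
    rw [← hψ1]
    exact (differentiableAt_of_deriv_ne_zero (by rw [hψ1]; norm_num)).derivWithin
      (uniqueDiffOn_Ici 0 0 self_mem_Ici)
  set D : ℝ → ℝ := derivWithin (derivWithin u (Ici 0)) (Ici 0) with hD
  have hDc : ContinuousOn D (Ici 0) :=
    (hu2.contDiffOn_derivWithin_Ici).continuousOn_derivWithin (uniqueDiffOn_Ici 0) le_rfl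
  set G : ℝ → ℝ := fun r => ψ r * D r
    + ((n : ℝ) - 1) * derivWithin ψ (Ici 0) r * derivWithin u (Ici 0) r
    + ψ r * (|u r| ^ (p - 1) * u r) with hG
  have hGc : ContinuousOn G (Ici 0) := by
    refine ((hψ.continuousOn.mul hDc).add ((continuousOn_const.mul
      hψ.contDiffOn_derivWithin_Ici.continuousOn).mul
      hu2.contDiffOn_derivWithin_Ici.continuousOn)).add (hψ.continuousOn.mul
      ((hu2.continuousOn.abs.rpow_const fun x _ => Or.inr (by linarith)).mul hu2.continuousOn))
  have hG0 : EqOn G 0 (Ioi 0) := by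
    intro r hr
    have hr : 0 < r := hr
    have hDr : D r = deriv (deriv u) r := by
      rw [hD, derivWithin_Ici_zero_of_pos hr, (hu2.hasDerivAt_derivWithin_of_pos hr).deriv]
    have h := hode r hr
    have hne := (hψpos r hr).ne'
    simp only [hG, hDr, derivWithin_Ici_zero_of_pos hr, Pi.zero_apply]
    field_simp at h
    linear_combination h
  have hz : G 0 = 0 := by
    have h := hG0.of_subset_closure hGc continuousOn_const Ioi_subset_Ici_self
      (by rw [closure_Ioi])
    exact h self_mem_Ici
  simp only [hG, hψ0, hψd, zero_mul, mul_one, zero_add, add_zero] at hz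
  have hn' : (3 : ℝ) ≤ n := by exact_mod_cast hn
  exact (mul_eq_zero.mp hz).resolve_left (by linarith)

/-- Since the energy `u'² / 2 + |u|^(p+1) / (p+1)` is nonincreasing, a radial solution is bounded by
its initial value. -/
theorem IsRadialSolution.abs_le {n : ℕ} {p : ℝ} {ψ u : ℝ → ℝ} {α : ℝ} (hn : 3 ≤ n)
    (hp : 1 < p) (h1 : H1 ψ) (h2 : H2 ψ) (hu : IsRadialSolution n p ψ u α) {r : ℝ} (hr : 0 ≤ r) :
    |u r| ≤ |α| := by
  have hv0 := hu.derivWithin_zero hn hp h1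
  obtain ⟨-, -, -, -, hψpos⟩ := h1
  obtain ⟨hu2, hu0, -, hode⟩ := hu
  have hn' : (3 : ℝ) ≤ n := by exact_mod_cast hn
  set v := derivWithin u (Ici 0) with hv
  set E : ℝ → ℝ := fun r => (p + 1) * v r ^ 2 / 2 + |u r| ^ (p + 1) with hE
  have hEc : ContinuousOn E (Ici 0) :=
    ((continuousOn_const.mul (hu2.contDiffOn_derivWithin_Ici.continuousOn.pow 2)).div_const 2).add
      (hu2.continuousOn.abs.rpow_const fun x _ => Or.inr (by linarith))
  have hEd : ∀ x : ℝ, 0 < x →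
      HasDerivAt E (-((p + 1) * ((n : ℝ) - 1) * (deriv ψ x / ψ x) * deriv u x ^ 2)) x := by
    intro x hx
    have hvx : v x = deriv u x := derivWithin_Ici_zero_of_pos hx
    have ha := (((hu2.hasDerivAt_derivWithin_of_pos hx).pow 2).const_mul (p + 1)).div_const 2
    have hb := (hasDerivAt_abs_rpow (u x) (p := p + 1) (by linarith)).comp x
      (hu2.hasDerivAt_of_pos hx)
    have hexp : p + 1 - 2 = p - 1 := by ring
    rw [hexp] at hb
    refine (ha.add hb).congr_deriv ?_
    rw [← hv, hvx]
    push_cast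
    linear_combination (p + 1) * deriv u x * hode x hx
  have hanti : AntitoneOn E (Ici 0) := by
    refine antitoneOn_of_deriv_nonpos (convex_Ici 0) hEc ?_ ?_
    · intro x hx
      rw [interior_Ici] at hx
      exact (hEd x hx).differentiableAt.differentiableWithinAt
    · intro x hx
      rw [interior_Ici] at hx
      rw [(hEd x hx).deriv, neg_nonpos]
      have h := div_nonneg (h2 x hx) (hψpos x hx).le
      have hn1 : (0 : ℝ) ≤ n - 1 := by linarith
      positivity
  have h := hanti self_mem_Ici (mem_Ici.mpr hr) hr
  simp only [hE, hv0, hu0] at h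
  have hsq : 0 ≤ (p + 1) * v r ^ 2 / 2 := by positivity
  rw [← Real.rpow_le_rpow_iff (abs_nonneg _) (abs_nonneg _) (show 0 < p + 1 by linarith)]
  linarith

theorem integrableOn_sq_mul_pow_of_hasCompactSupport {n : ℕ} {ψ χ : ℝ → ℝ}
    (hψ : ContinuousOn ψ (Ici 0)) (hχ : Continuous χ) (hc : HasCompactSupport χ) :
    IntegrableOn (fun r => χ r ^ 2 * ψ r ^ (n - 1)) (Ioi 0) := by
  have hcont : ContinuousOn (fun r => χ r ^ 2 * ψ r ^ (n - 1)) (Ici 0) :=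
    (hχ.pow 2).continuousOn.mul (hψ.pow _)
  have hK : IntegrableOn (fun r => χ r ^ 2 * ψ r ^ (n - 1)) (Ici 0 ∩ tsupport χ) :=
    (hcont.mono inter_subset_left).integrableOn_compact (hc.isCompact.inter_left isClosed_Ici)
  refine (hK.of_forall_sdiff_eq_zero measurableSet_Ici ?_).mono_set Ioi_subset_Ici_self
  rintro x ⟨hx, hxK⟩
  simp [image_eq_zero_of_notMem_tsupport fun h => hxK ⟨hx, h⟩]

theorem lam1_mul_le {n : ℕ} {ψ φ : ℝ → ℝ} (hψ : ∀ r > (0 : ℝ), 0 < ψ r)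
    (hφ : ContDiff ℝ 1 φ) (hc : HasCompactSupport φ) :
    lam1 n ψ * ∫ r in Ioi (0 : ℝ), φ r ^ 2 * ψ r ^ (n - 1) ≤
      ∫ r in Ioi (0 : ℝ), deriv φ r ^ 2 * ψ r ^ (n - 1) := by
  have hnn : ∀ f : ℝ → ℝ, 0 ≤ ∫ r in Ioi (0 : ℝ), f r ^ 2 * ψ r ^ (n - 1) := fun f =>
    setIntegral_nonneg measurableSet_Ioi fun r hr =>
      mul_nonneg (sq_nonneg _) (pow_nonneg (hψ r hr).le _)
  by_cases h0 : ∫ r in Ioi (0 : ℝ), φ r ^ 2 * ψ r ^ (n - 1) = 0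
  · rw [h0, mul_zero]
    exact hnn _
  · rw [← le_div_iff₀ ((hnn φ).lt_of_ne' h0)]
    refine csInf_le ⟨0, ?_⟩ ⟨φ, hφ, hc, h0, rfl⟩
    rintro q ⟨f, -, -, -, rfl⟩
    exact div_nonneg (hnn _) (hnn _)

/-- Radial solutions with 0 < |α| ≤ (λ₁/p)^{1/(p-1)} are stable. -/
theorem statement19 (n : ℕ) (hn : 3 ≤ n) (p : ℝ) (hp : 1 < p) (ψ : ℝ → ℝ)
    (h1 : H1 ψ) (h2 : H2 ψ) (h3 : H3 ψ)
    (hlam : 0 < lam1 n ψ)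
    (α : ℝ) (hα0 : α ≠ 0) (hα : |α| ≤ (lam1 n ψ / p) ^ (1 / (p - 1)))
    (u : ℝ → ℝ) (hu : IsRadialSolution n p ψ u α) :
    Stable n p ψ u := by
  intro χ hχ hc
  have hp0 : 0 < p := by linarith
  have hp1 : 0 < p - 1 := by linarith
  have hbound : ∀ r > (0 : ℝ), p * |u r| ^ (p - 1) ≤ lam1 n ψ := by
    intro r hr
    have h : |u r| ^ (p - 1) ≤ lam1 n ψ / p := by
      calc |u r| ^ (p - 1) ≤ ((lam1 n ψ / p) ^ (1 / (p - 1))) ^ (p - 1) :=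
            Real.rpow_le_rpow (abs_nonneg _) ((hu.abs_le hn hp h1 h2 hr.le).trans hα) hp1.le
        _ = lam1 n ψ / p := by
            rw [← Real.rpow_mul (by positivity), one_div_mul_cancel hp1.ne', Real.rpow_one]
    rw [le_div_iff₀ hp0] at h
    linarith
  have hψpos := h1.2.2.2.2
  refine le_trans ?_ (lam1_mul_le hψpos hχ hc)
  rw [← integral_const_mul, ← integral_const_mul]
  refine integral_mono_of_nonneg ?_ ((integrableOn_sq_mul_pow_of_hasCompactSupport
    h1.1.continuousOn hχ.continuous hc).const_mul _) ?_
  · filter_upwards [ae_restrict_mem measurableSet_Ioi] with r hr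
    have := hψpos r hr
    simp only [Pi.zero_apply]
    positivity
  · filter_upwards [ae_restrict_mem measurableSet_Ioi] with r hr
    have h := mul_le_mul_of_nonneg_right (hbound r hr)
      (mul_nonneg (sq_nonneg (χ r)) (pow_nonneg (hψpos r hr).le (n - 1)))
    simpa only [mul_assoc] using h
end
end
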